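/- Let A be a finite-dimensional algebra over a field F, let S_i and S_j be simple right A-modules with projective covers P_i and P_j respectively, and let n ≥ 1 be an integer. Then there is an F-linear isomorphism Hom_A(rad^{n-1}(P_i)/rad^n(P_i), S_j) ≅ Hom_{A^op}(rad^{n-1}(P_j^t)/rad^n(P_j^t), S_i^*), where P_j^t = Hom_A(P_j, A) is the A-dual of P_j (a left A-module, i.e., a right A^op-module) and S_i^* = Hom_F(S_i, F) is the F-dual of S_i. -/

import Mathlib

set_option linter.unusedSectionVars false
set_option synthInstance.maxHeartbeats 1000000
set_option maxHeartbeats 1000000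

open Module MulOpposite

/-! ### Loewy-theoretic definitions: socle, radical, their iterates and layers -/

section LoewyDefs

variable (R : Type*) [Ring R]

/-- The socle of a module: the sum of its minimal (= atomic) submodules. -/
def socSub (M : Type*) [AddCommGroup M] [Module R M] : Submodule R M :=
  sSup {m : Submodule R M | IsAtom m}

/-- The radical of a module: the intersection of its maximal (= coatomic) submodules. -/
def radSub (M : Type*) [AddCommGroup M] [Module R M] : Submodule R M :=
  sInf {m : Submodule R M | IsCoatom m}

/-- The `n`-th radical: `rad^0 M = M` and `rad^{n+1} M = rad (rad^n M)`,
viewed as a submodule of `M`. -/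
def radPow (M : Type*) [AddCommGroup M] [Module R M] : ℕ → Submodule R M
  | 0 => ⊤
  | n + 1 => (radSub R (radPow M n)).map (radPow M n).subtype

/-- The `n`-th socle: `soc^0 M = 0` and `soc^{n+1} M` is the preimage of
`soc (M / soc^n M)` under the canonical projection. -/
def socPow (M : Type*) [AddCommGroup M] [Module R M] : ℕ → Submodule R M
  | 0 => ⊥
  | n + 1 => (socSub R (M ⧸ socPow M n)).comap (socPow M n).mkQ

/-- The `n`-th radical layer `rad_n M = rad^{n-1} M / rad^n M`. -/
abbrev radLayer (M : Type*) [AddCommGroup M] [Module R M] (n : ℕ) :=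
  ↥(radPow R M (n - 1)) ⧸ (radPow R M n).comap (radPow R M (n - 1)).subtype

/-- The `n`-th socle layer `soc_n M = soc^n M / soc^{n-1} M`. -/
abbrev socLayer (M : Type*) [AddCommGroup M] [Module R M] (n : ℕ) :=
  ↥(socPow R M n) ⧸ (socPow R M (n - 1)).comap (socPow R M n).subtype

/-- The `n`-th capital `cap^n M = M / rad^n M`. -/
abbrev capital (M : Type*) [AddCommGroup M] [Module R M] (n : ℕ) :=
  M ⧸ radPow R M n

end LoewyDefs

/-! ### Contragredient dual module structures -/

section DualMod
variable (F A : Type*) [Field F] [Ring A] [Algebra F A]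

/-- Contragredient action: the `F`-dual of a right `A`-module is a left `A`-module,
via `(a • l) m = l (op a • m)`. -/
noncomputable instance dualModuleOfRight (M : Type*) [AddCommGroup M] [Module F M]
    [Module Aᵐᵒᵖ M] [SMulCommClass Aᵐᵒᵖ F M] : Module A (Module.Dual F M) where
  smul a l := l.comp (DistribMulAction.toLinearMap F M (op a))
  one_smul l := LinearMap.ext fun m => congrArg l (one_smul Aᵐᵒᵖ m)
  mul_smul a b l := LinearMap.ext fun m => congrArg l (mul_smul (op b) (op a) m)
  smul_zero a := rfl
  smul_add a l₁ l₂ := rfl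
  add_smul a b l := LinearMap.ext fun m => by
    rw [LinearMap.add_apply]
    show l (op (a + b) • m) = l (op a • m) + l (op b • m)
    rw [← map_add]
    congr 1
    show (op a + op b) • m = _
    rw [add_smul]
  zero_smul l := LinearMap.ext fun m => by
    show l ((0 : Aᵐᵒᵖ) • m) = 0
    rw [zero_smul, map_zero]

@[simp] lemma dualModuleOfRight_smul_apply (M : Type*) [AddCommGroup M] [Module F M]
    [Module Aᵐᵒᵖ M] [SMulCommClass Aᵐᵒᵖ F M] (a : A) (l : Module.Dual F M) (m : M) :
    (a • l) m = l (op a • m) := rfl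

/-- Contragredient action: the `F`-dual of a left `A`-module is a right `A`-module,
via `(a • l) m = l (a.unop • m)`. -/
noncomputable instance dualModuleOfLeft (N : Type*) [AddCommGroup N] [Module F N]
    [Module A N] [SMulCommClass A F N] : Module Aᵐᵒᵖ (Module.Dual F N) where
  smul a l := l.comp (DistribMulAction.toLinearMap F N a.unop)
  one_smul l := LinearMap.ext fun m => congrArg l (one_smul A m)
  mul_smul a b l := LinearMap.ext fun m => congrArg l (mul_smul b.unop a.unop m)
  smul_zero a := rfl
  smul_add a l₁ l₂ := rfl
  add_smul a b l := LinearMap.ext fun m => by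
    rw [LinearMap.add_apply]
    show l ((a + b).unop • m) = l (a.unop • m) + l (b.unop • m)
    rw [← map_add]
    congr 1
    show (a.unop + b.unop) • m = _
    rw [add_smul]
  zero_smul l := LinearMap.ext fun m => by
    show l ((0 : A) • m) = 0
    rw [zero_smul, map_zero]

@[simp] lemma dualModuleOfLeft_smul_apply (N : Type*) [AddCommGroup N] [Module F N]
    [Module A N] [SMulCommClass A F N] (a : Aᵐᵒᵖ) (l : Module.Dual F N) (m : N) :
    (a • l) m = l (a.unop • m) := rfl

noncomputable instance dualTowerOfRight (M : Type*) [AddCommGroup M] [Module F M]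
    [Module Aᵐᵒᵖ M] [IsScalarTower F Aᵐᵒᵖ M] : IsScalarTower F A (Module.Dual F M) where
  smul_assoc c a l := LinearMap.ext fun m => by
    show l (op (c • a) • m) = c • l (op a • m)
    rw [← map_smul]
    congr 1
    show (c • op a) • m = c • op a • m
    rw [smul_assoc]

noncomputable instance dualTowerOfLeft (N : Type*) [AddCommGroup N] [Module F N]
    [Module A N] [IsScalarTower F A N] : IsScalarTower F Aᵐᵒᵖ (Module.Dual F N) where
  smul_assoc c a l := LinearMap.ext fun m => by
    show l ((c • a).unop • m) = c • l (a.unop • m)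
    rw [← map_smul]
    congr 1
    show (c • a.unop) • m = c • a.unop • m
    rw [smul_assoc]

end DualMod

section Radical

variable {R : Type*} [Ring R] [IsArtinianRing R]

theorem isSemisimpleModule_of_jacobson_smul_top_eq_bot {M : Type*} [AddCommGroup M] [Module R M]
    (h : Ring.jacobson R • (⊤ : Submodule R M) = ⊥) : IsSemisimpleModule R M := by
  have hM : Module.IsTorsionBySet R M (Ring.jacobson R) := fun m i ↦ by
    have : i.1 • m ∈ Ring.jacobson R • (⊤ : Submodule R M) :=
      Submodule.smul_mem_smul i.2 trivial
    rwa [h] at this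
  let _ := hM.module
  exact (hM.semilinearMap.isSemisimpleModule_iff_of_bijective Function.bijective_id).2
    inferInstance

theorem radSub_eq_jacobson_smul_top (M : Type*) [AddCommGroup M] [Module R M] :
    radSub R M = Ring.jacobson R • (⊤ : Submodule R M) := by
  refine le_antisymm ?_ (Ring.jacobson_smul_top_le R M)
  refine Module.jacobson_le_of_eq_bot ?_
  have : IsSemisimpleModule R (M ⧸ Ring.jacobson R • (⊤ : Submodule R M)) := by
    refine isSemisimpleModule_of_jacobson_smul_top_eq_bot ?_
    rw [← Submodule.range_mkQ, LinearMap.range_eq_map, ← Submodule.map_smul'',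
      Submodule.mkQ_map_self]
  exact IsSemisimpleModule.jacobson_eq_bot R _

theorem radPow_eq_jacobson_pow_smul_top (M : Type*) [AddCommGroup M] [Module R M] (n : ℕ) :
    radPow R M n = Ring.jacobson R ^ n • (⊤ : Submodule R M) := by
  induction n with
  | zero => rw [radPow, Submodule.pow_zero, Ideal.one_eq_top, Submodule.top_smul]
  | succ n ih =>
    rw [radPow, radSub_eq_jacobson_smul_top, Submodule.map_smul'', Submodule.map_top,
      Submodule.range_subtype, ih, ← Submodule.mul_smul]
    rw [Ideal.IsTwoSided.pow_succ]

theorem radPow_succ_eq_smul (M : Type*) [AddCommGroup M] [Module R M] (n : ℕ) :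
    radPow R M (n + 1) = Ring.jacobson R • radPow R M n := by
  rw [radPow, radSub_eq_jacobson_smul_top, Submodule.map_smul'', Submodule.map_top,
    Submodule.range_subtype]

theorem radPow_self (n : ℕ) : radPow R R n = Ring.jacobson R ^ n := by
  rw [radPow_eq_jacobson_pow_smul_top, smul_eq_mul, ← Ideal.one_eq_top, Ideal.IsTwoSided.mul_one]

theorem map_mem_radPow {M N : Type*} [AddCommGroup M] [Module R M] [AddCommGroup N] [Module R N]
    (f : M →ₗ[R] N) {n : ℕ} {x : M} (hx : x ∈ radPow R M n) : f x ∈ radPow R N n := by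
  rw [radPow_eq_jacobson_pow_smul_top] at hx ⊢
  have := Submodule.mem_map_of_mem (f := f) hx
  rw [Submodule.map_smul''] at this
  exact Submodule.smul_mono le_rfl le_top this

theorem smul_mem_radPow {M : Type*} [AddCommGroup M] [Module R M] {n : ℕ} {r : R}
    (hr : r ∈ Ring.jacobson R ^ n) (x : M) : r • x ∈ radPow R M n := by
  rw [radPow_eq_jacobson_pow_smul_top]
  exact Submodule.smul_mem_smul hr trivial

theorem isSemisimpleModule_radLayer_succ (M : Type*) [AddCommGroup M] [Module R M] (n : ℕ) :
    IsSemisimpleModule R (radLayer R M (n + 1)) := by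
  refine isSemisimpleModule_of_jacobson_smul_top_eq_bot (Submodule.smul_le.2 ?_ |> le_bot_iff.1)
  intro r hr m _
  obtain ⟨m, rfl⟩ := Submodule.mkQ_surjective _ m
  rw [← map_smul]
  refine (Submodule.Quotient.mk_eq_zero _).2 ?_
  change r • m.1 ∈ radPow R M (n + 1)
  rw [radPow_succ_eq_smul]
  exact Submodule.smul_mem_smul hr m.2

theorem op_mem_jacobson {a : R} (ha : a ∈ Ring.jacobson R) : op a ∈ Ring.jacobson Rᵐᵒᵖ := by
  rw [← Ideal.jacobson_bot, Ideal.mem_jacobson_iff]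
  intro y
  obtain ⟨k, hk⟩ := IsArtinianRing.isNilpotent_jacobson_bot (R := R)
  have h : IsNilpotent (a * y.unop) := by
    refine ⟨k, ?_⟩
    have : (a * y.unop) ^ k ∈ Ideal.jacobson (⊥ : Ideal R) ^ k := by
      refine Ideal.pow_mem_pow ?_ k
      rw [Ideal.jacobson_bot]
      exact Ideal.mul_mem_right _ _ ha
    rwa [hk] at this
  obtain ⟨u, hu⟩ := h.isUnit_add_one
  refine ⟨op (↑u⁻¹ : R), ?_⟩
  rw [Submodule.mem_bot]
  apply unop_injective
  simp only [unop_sub, unop_add, unop_mul, unop_op, unop_one, unop_zero]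
  have h1 : (a * y.unop + 1) * (↑u⁻¹ : R) = 1 := by rw [← hu]; simp
  rw [sub_eq_zero, ← h1]; noncomm_ring

theorem unop_mem_jacobson {R : Type*} [Ring R] [IsArtinianRing Rᵐᵒᵖ] {a : Rᵐᵒᵖ}
    (ha : a ∈ Ring.jacobson Rᵐᵒᵖ) : a.unop ∈ Ring.jacobson R := by
  rw [← Ideal.jacobson_bot, Ideal.mem_jacobson_iff]
  intro y
  obtain ⟨k, hk⟩ := IsArtinianRing.isNilpotent_jacobson_bot (R := Rᵐᵒᵖ)
  have h : IsNilpotent (a * op y) := by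
    refine ⟨k, ?_⟩
    have : (a * op y) ^ k ∈ Ideal.jacobson (⊥ : Ideal Rᵐᵒᵖ) ^ k := by
      refine Ideal.pow_mem_pow ?_ k
      rw [Ideal.jacobson_bot]
      exact Ideal.mul_mem_right _ _ ha
    rwa [hk] at this
  obtain ⟨u, hu⟩ := h.isUnit_add_one
  refine ⟨(↑u⁻¹ : Rᵐᵒᵖ).unop, ?_⟩
  rw [Submodule.mem_bot]
  apply op_injective
  simp only [op_sub, op_add, op_mul, op_unop, op_one, op_zero]
  have h1 : (a * op y + 1) * (↑u⁻¹ : Rᵐᵒᵖ) = 1 := by rw [← hu]; simp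
  rw [sub_eq_zero, ← h1]; noncomm_ring

theorem op_mem_jacobson_pow {a : R} {n : ℕ} (ha : a ∈ Ring.jacobson R ^ n) :
    op a ∈ Ring.jacobson Rᵐᵒᵖ ^ n := by
  induction n generalizing a with
  | zero => simp [Submodule.pow_zero, Ideal.one_eq_top]
  | succ n ih =>
    rw [Submodule.pow_succ, ← smul_eq_mul] at ha
    refine Submodule.smul_induction_on ha (fun x hx y hy ↦ ?_) (fun x y hx hy ↦ add_mem hx hy)
    rw [Ideal.IsTwoSided.pow_succ, smul_eq_mul, op_mul]
    exact Ideal.mul_mem_mul (op_mem_jacobson hy) (ih hx)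

theorem unop_mem_jacobson_pow {R : Type*} [Ring R] [IsArtinianRing Rᵐᵒᵖ] {a : Rᵐᵒᵖ} {n : ℕ}
    (ha : a ∈ Ring.jacobson Rᵐᵒᵖ ^ n) : a.unop ∈ Ring.jacobson R ^ n := by
  induction n generalizing a with
  | zero => simp [Submodule.pow_zero, Ideal.one_eq_top]
  | succ n ih =>
    rw [Submodule.pow_succ, ← smul_eq_mul] at ha
    refine Submodule.smul_induction_on ha (fun x hx y hy ↦ ?_) (fun x y hx hy ↦ add_mem hx hy)
    rw [Ideal.IsTwoSided.pow_succ, smul_eq_mul, unop_mul]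
    exact Ideal.mul_mem_mul (unop_mem_jacobson hy) (ih hx)

end Radical

section HomDuality

variable {F R : Type*} [Field F] [Ring R] [Algebra F R]

theorem nonempty_linearEquiv_hom_swap_of_isSimpleModule (S T : Type*)
    [AddCommGroup S] [Module R S] [Module F S] [IsScalarTower F R S] [IsSimpleModule R S]
    [AddCommGroup T] [Module R T] [Module F T] [IsScalarTower F R T] [IsSimpleModule R T] :
    Nonempty ((S →ₗ[R] T) ≃ₗ[F] (T →ₗ[R] S)) := by
  by_cases h : Nonempty (S ≃ₗ[R] T)
  · obtain ⟨e⟩ := h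
    exact ⟨{
      toFun := fun f ↦ e.symm.toLinearMap ∘ₗ f ∘ₗ e.symm.toLinearMap
      invFun := fun f ↦ e.toLinearMap ∘ₗ f ∘ₗ e.toLinearMap
      map_add' := fun f g ↦ by ext; simp
      map_smul' := fun c f ↦ by
        ext x
        exact LinearMap.map_smul_of_tower e.symm.toLinearMap c (f (e.symm x))
      left_inv := fun f ↦ by ext; simp
      right_inv := fun f ↦ by ext; simp }⟩
  · have h1 : ∀ f : S →ₗ[R] T, f = 0 := fun f ↦ by
      by_contra hf
      exact h ⟨LinearEquiv.ofBijective f (LinearMap.bijective_of_ne_zero hf)⟩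
    have h2 : ∀ f : T →ₗ[R] S, f = 0 := fun f ↦ by
      by_contra hf
      exact h ⟨(LinearEquiv.ofBijective f (LinearMap.bijective_of_ne_zero hf)).symm⟩
    exact ⟨{ (0 : (S →ₗ[R] T) →ₗ[F] (T →ₗ[R] S)) with
      invFun := 0
      left_inv := fun f ↦ (h1 f).symm
      right_inv := fun f ↦ (h2 f).symm }⟩

theorem nonempty_linearEquiv_hom_swap (L S : Type*)
    [AddCommGroup L] [Module R L] [Module F L] [IsScalarTower F R L] [IsSemisimpleModule R L]
    [Module.Finite R L]
    [AddCommGroup S] [Module R S] [Module F S] [IsScalarTower F R S] [IsSimpleModule R S] :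
    Nonempty ((L →ₗ[R] S) ≃ₗ[F] (S →ₗ[R] L)) := by
  obtain ⟨n, T, e, hT⟩ := IsSemisimpleModule.exists_linearEquiv_fin_dfinsupp R L
  have e' : L ≃ₗ[R] (Π i, T i) := e.trans DFinsupp.linearEquivFunOnFintype
  have (i : Fin n) := (nonempty_linearEquiv_hom_swap_of_isSimpleModule (F := F) (R := R) (T i) S)
  have g (i : Fin n) := (this i).some
  let p : (Π i, S →ₗ[R] T i) ≃ₗ[F] (S →ₗ[R] L) :=
    { toFun := fun f ↦ e'.symm.toLinearMap ∘ₗ LinearMap.pi f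
      invFun := fun f i ↦ LinearMap.proj i ∘ₗ e'.toLinearMap ∘ₗ f
      map_add' := fun f g ↦ by
        ext x
        simp only [LinearMap.comp_apply, LinearMap.add_apply, ← map_add]
        rfl
      map_smul' := fun c f ↦ by
        ext x
        exact LinearMap.map_smul_of_tower e'.symm.toLinearMap c (LinearMap.pi f x)
      left_inv := fun f ↦ by ext; simp
      right_inv := fun f ↦ by
        ext x
        simp only [LinearMap.comp_apply, LinearEquiv.coe_coe]
        rw [LinearEquiv.symm_apply_eq]
        rfl }
  exact ⟨(LinearEquiv.congrLeft S F e').trans <| (LinearMap.lsum R (fun i ↦ T i) F).symm.trans <|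
    (LinearEquiv.piCongrRight g).trans p⟩

theorem nonempty_linearEquiv_hom_of_ker_le_radSub {P S : Type*}
    [AddCommGroup P] [Module R P] [AddCommGroup S] [Module R S]
    (π : P →ₗ[R] S) (hs : Function.Surjective π) (hk : LinearMap.ker π ≤ radSub R P) (L : Type*)
    [AddCommGroup L] [Module R L] [Module F L] [IsScalarTower F R L] [IsSemisimpleModule R L] :
    Nonempty ((S →ₗ[R] L) ≃ₗ[F] (P →ₗ[R] L)) := by
  refine ⟨LinearEquiv.ofBijective
    { toFun := fun f ↦ f ∘ₗ π
      map_add' := fun _ _ ↦ rfl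
      map_smul' := fun _ _ ↦ rfl } ⟨fun f g h ↦ ?_, fun f ↦ ?_⟩⟩
  · exact (LinearMap.cancel_right hs).1 h
  · have hf : LinearMap.ker π ≤ LinearMap.ker f :=
      hk.trans (IsSemisimpleModule.jacobson_le_ker R R P L f)
    refine ⟨(LinearMap.ker π).liftQ f hf ∘ₗ (π.quotKerEquivOfSurjective hs).symm.toLinearMap, ?_⟩
    ext x
    have : (π.quotKerEquivOfSurjective hs).symm (π x) = (LinearMap.ker π).mkQ x := by
      rw [LinearEquiv.symm_apply_eq]
      rfl
    simp [this]

end HomDuality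

section Cyclic

theorem exists_generator_of_projectiveCover {A S P : Type*} [Ring A]
    [AddCommGroup S] [Module Aᵐᵒᵖ S] [IsSimpleModule Aᵐᵒᵖ S]
    [AddCommGroup P] [Module Aᵐᵒᵖ P] [Module.Finite Aᵐᵒᵖ P] [Module.Projective Aᵐᵒᵖ P]
    (π : P →ₗ[Aᵐᵒᵖ] S) (hs : Function.Surjective π) (hk : LinearMap.ker π ≤ radSub Aᵐᵒᵖ P) :
    ∃ (p : P) (t : P →ₗ[Aᵐᵒᵖ] A), ∀ x, op (t x) • p = x := by
  have := IsSimpleModule.nontrivial Aᵐᵒᵖ S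
  obtain ⟨s, hs0⟩ := exists_ne (0 : S)
  obtain ⟨p, rfl⟩ := hs s
  have hp : Submodule.span Aᵐᵒᵖ {p} = ⊤ := by
    by_contra hne
    obtain ⟨m, hm, hle⟩ := (eq_top_or_exists_le_coatom _).resolve_left hne
    have hkm : LinearMap.ker π ≤ m := hk.trans (sInf_le hm)
    refine hm.1 (eq_top_iff.2 fun x _ ↦ ?_)
    have : π x ∈ Submodule.span Aᵐᵒᵖ {π p} := by
      rw [IsSimpleModule.span_singleton_eq_top Aᵐᵒᵖ hs0]; trivial
    obtain ⟨a, ha⟩ := Submodule.mem_span_singleton.1 this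
    have h1 : x - a • p ∈ m := hkm (by simp [ha])
    have h2 : a • p ∈ m := m.smul_mem a (hle (Submodule.mem_span_singleton_self p))
    simpa using m.add_mem h1 h2
  have hsurj : Function.Surjective (LinearMap.toSpanSingleton Aᵐᵒᵖ P p) := by
    rw [← LinearMap.range_eq_top, LinearMap.range_toSpanSingleton, hp]
  obtain ⟨t, ht⟩ := Module.projective_lifting_property _ LinearMap.id hsurj
  refine ⟨p, ⟨⟨fun x ↦ (t x).unop, fun x y ↦ by simp⟩, fun a x ↦ by simp⟩, fun x ↦ ?_⟩
  exact LinearMap.congr_fun ht x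

end Cyclic


section PeirceComponent

variable {A : Type*} [Ring A]

theorem apply_mul_apply_of_generator {P : Type*} [AddCommGroup P] [Module Aᵐᵒᵖ P] {p : P}
    {t : P →ₗ[Aᵐᵒᵖ] A} (ht : ∀ x, op (t x) • p = x) (f : P →ₗ[Aᵐᵒᵖ] A) (x : P) :
    f p * t x = f x := by
  conv_rhs => rw [← ht x, map_smul]
  rfl

theorem apply_mem_jacobson_pow [IsArtinianRing Aᵐᵒᵖ] {P : Type*} [AddCommGroup P] [Module Aᵐᵒᵖ P]
    (t : P →ₗ[Aᵐᵒᵖ] A) {n : ℕ} {x : P} (hx : x ∈ radPow Aᵐᵒᵖ P n) :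
    t x ∈ Ring.jacobson A ^ n := by
  let s : P →ₗ[Aᵐᵒᵖ] Aᵐᵒᵖ :=
    { toFun := fun x ↦ op (t x)
      map_add' := fun x y ↦ by simp
      map_smul' := fun a x ↦ by
        apply unop_injective
        simp }
  have := map_mem_radPow s hx
  rw [radPow_self] at this
  exact unop_mem_jacobson_pow this

theorem eval_mem_jacobson_pow [IsArtinianRing A] {P : Type*} [AddCommGroup P] [Module Aᵐᵒᵖ P]
    (p : P) {n : ℕ} {q : P →ₗ[Aᵐᵒᵖ] A} (hq : q ∈ radPow A (P →ₗ[Aᵐᵒᵖ] A) n) :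
    q p ∈ Ring.jacobson A ^ n := by
  let ev : (P →ₗ[Aᵐᵒᵖ] A) →ₗ[A] A :=
    { toFun := fun q ↦ q p
      map_add' := fun _ _ ↦ rfl
      map_smul' := fun _ _ ↦ rfl }
  have := map_mem_radPow ev hq
  rwa [radPow_self] at this

variable (F : Type*) [Field F] [Algebra F A]

/-- The elements `v` of the `m`-th power of the Jacobson radical such that `e * v * e'` lies in the
next power. -/
def peirceKer (e e' : A) (m : ℕ) :
    Submodule F ((Ring.jacobson A ^ m).restrictScalars F) :=
  ((Ring.jacobson A ^ (m + 1)).restrictScalars F).comap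
    (LinearMap.mulRight F e' ∘ₗ LinearMap.mulLeft F e ∘ₗ Submodule.subtype _)

variable {F}

theorem mem_peirceKer {e e' : A} {m : ℕ} {v : (Ring.jacobson A ^ m).restrictScalars F} :
    v ∈ peirceKer F e e' m ↔ e * v.1 * e' ∈ Ring.jacobson A ^ (m + 1) := Iff.rfl

variable {P P' : Type*} [AddCommGroup P] [Module Aᵐᵒᵖ P] [AddCommGroup P'] [Module Aᵐᵒᵖ P']
  {p : P} {t : P →ₗ[Aᵐᵒᵖ] A} {p' : P'} {t' : P' →ₗ[Aᵐᵒᵖ] A}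

theorem nonempty_peirce_equiv_hom_radLayer [Module F P] [IsScalarTower F Aᵐᵒᵖ P]
    [IsArtinianRing A] [IsArtinianRing Aᵐᵒᵖ]
    (ht : ∀ x, op (t x) • p = x) (ht' : ∀ x, op (t' x) • p' = x) (m : ℕ) :
    Nonempty ((_ ⧸ peirceKer F (t p) (t' p') m) ≃ₗ[F]
      (P' →ₗ[Aᵐᵒᵖ] radLayer Aᵐᵒᵖ P (m + 1))) := by
  let g (v : (Ring.jacobson A ^ m).restrictScalars F) : P' →ₗ[Aᵐᵒᵖ] radPow Aᵐᵒᵖ P m :=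
    { toFun := fun y ↦ ⟨op (v.1 * t' y) • p,
        smul_mem_radPow (op_mem_jacobson_pow (Ideal.mul_mem_right _ _ v.2)) p⟩
      map_add' := fun x y ↦ Subtype.ext <| by
        simp [mul_add, add_smul]
      map_smul' := fun a y ↦ Subtype.ext <| by
        simp only [map_smul, MulOpposite.smul_eq_mul_unop, ← mul_assoc, op_mul _ a.unop, mul_smul]
        simp }
  let Φ : (Ring.jacobson A ^ m).restrictScalars F →ₗ[F]
      (P' →ₗ[Aᵐᵒᵖ] radLayer Aᵐᵒᵖ P (m + 1)) :=
    { toFun := fun v ↦ Submodule.mkQ _ ∘ₗ g v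
      map_add' := fun v w ↦ by
        ext y
        have : g (v + w) y = g v y + g w y := Subtype.ext <| by simp [g, mul_add, add_smul]
        simp [this]
      map_smul' := fun c v ↦ by
        ext y
        have : g (c • v) y = c • g v y := Subtype.ext <| by simp [g]
        simp [this] }
  have hΦ : ∀ v y, Φ v y = 0 ↔ op (v.1 * t' y) • p ∈ radPow Aᵐᵒᵖ P (m + 1) := fun v y ↦
    Submodule.Quotient.mk_eq_zero _
  have hker : LinearMap.ker Φ = peirceKer F (t p) (t' p') m := by
    ext v
    rw [LinearMap.mem_ker, mem_peirceKer]
    constructor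
    · intro h
      have := apply_mem_jacobson_pow t ((hΦ v p').1 (by rw [h]; rfl))
      rw [map_smul] at this
      simpa [mul_assoc] using this
    · intro h
      ext y
      rw [LinearMap.zero_apply, hΦ]
      have h1 : op (t p * v.1 * t' p' * t' y) • p ∈ radPow Aᵐᵒᵖ P (m + 1) :=
        smul_mem_radPow (op_mem_jacobson_pow (Ideal.mul_mem_right _ _ h)) p
      rwa [mul_assoc, mul_assoc, apply_mul_apply_of_generator ht', op_mul (t p), mul_smul,
        ht p] at h1
  have hsurj : Function.Surjective Φ := by
    intro φ
    obtain ⟨x, hx⟩ := Submodule.mkQ_surjective _ (φ p')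
    refine ⟨⟨t x.1, apply_mem_jacobson_pow t x.2⟩, ?_⟩
    ext y
    conv_rhs => rw [← ht' y, map_smul, ← hx, ← map_smul]
    refine congrArg (Submodule.mkQ _) (Subtype.ext ?_)
    change op (t x.1 * t' y) • p = op (t' y) • x.1
    rw [op_mul, mul_smul, ht]
  rw [← hker]
  exact ⟨Φ.quotKerEquivOfSurjective hsurj⟩

variable [IsArtinianRing A] [IsArtinianRing Aᵐᵒᵖ]
  [Module F P] [IsScalarTower F Aᵐᵒᵖ P]
  {S : Type*} [AddCommGroup S] [Module Aᵐᵒᵖ S] [Module F S] [IsScalarTower F Aᵐᵒᵖ S]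

/-- The class of `v • t'` in the radical layer of the dual of `P'`, for `v` in a power of the
Jacobson radical. -/
def layerClass (F : Type*) [Field F] [Algebra F A] (t' : P' →ₗ[Aᵐᵒᵖ] A) (m : ℕ) :
    (Ring.jacobson A ^ m).restrictScalars F →ₗ[F] radLayer A (P' →ₗ[Aᵐᵒᵖ] A) (m + 1) where
  toFun v := Submodule.Quotient.mk ⟨v.1 • t', smul_mem_radPow v.2 t'⟩
  map_add' v w := by
    rw [← Submodule.Quotient.mk_add]
    exact congrArg _ (Subtype.ext (add_smul v.1 w.1 t'))
  map_smul' c v := by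
    rw [RingHom.id_apply, ← Submodule.Quotient.mk_smul]
    exact congrArg _ (Subtype.ext (smul_assoc c v.1 t'))

theorem smul_layerClass (a : A) {m : ℕ} (v : (Ring.jacobson A ^ m).restrictScalars F) :
    a • layerClass F t' m v = layerClass F t' m ⟨a * v.1, Ideal.mul_mem_left _ _ v.2⟩ := by
  change Submodule.Quotient.mk _ = Submodule.Quotient.mk _
  exact congrArg _ (Subtype.ext (smul_smul a v.1 t'))

theorem layerClass_eq_zero (ht' : ∀ x, op (t' x) • p' = x) {m : ℕ}
    {v : (Ring.jacobson A ^ m).restrictScalars F}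
    (hv : v.1 * t' p' ∈ Ring.jacobson A ^ (m + 1)) : layerClass F t' m v = 0 := by
  refine (Submodule.Quotient.mk_eq_zero _).2 ?_
  change v.1 • t' ∈ radPow A (P' →ₗ[Aᵐᵒᵖ] A) (m + 1)
  have h1 : v.1 • t' = (v.1 * t' p') • t' := by
    ext y
    simp only [LinearMap.smul_apply, smul_eq_mul, mul_assoc, apply_mul_apply_of_generator ht']
  rw [h1]
  exact smul_mem_radPow hv t'

theorem mk_eq_layerClass (ht' : ∀ x, op (t' x) • p' = x) {m : ℕ}
    (q : radPow A (P' →ₗ[Aᵐᵒᵖ] A) m) :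
    (Submodule.Quotient.mk q : radLayer A (P' →ₗ[Aᵐᵒᵖ] A) (m + 1)) =
      layerClass F t' m ⟨q.1 p', eval_mem_jacobson_pow p' q.2⟩ := by
  refine congrArg _ (Subtype.ext (LinearMap.ext fun y ↦ ?_))
  exact (apply_mul_apply_of_generator ht' q.1 y).symm

theorem hom_dual_apply_apply (ht : ∀ x, op (t x) • p = x) (π : P →ₗ[Aᵐᵒᵖ] S)
    {L : Type*} [AddCommGroup L] [Module A L] (φ : L →ₗ[A] Module.Dual F S) (y : L) (x : P) :
    φ y (π x) = φ (t x • y) (π p) := by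
  conv_lhs => rw [← ht x, map_smul]
  rw [LinearMap.map_smul φ]
  rfl

theorem apply_mem_jacobson_of_mem_ker {π : P →ₗ[Aᵐᵒᵖ] S}
    (hk : LinearMap.ker π ≤ radSub Aᵐᵒᵖ P) (t : P →ₗ[Aᵐᵒᵖ] A) {z : P} (hz : π z = 0) :
    t z ∈ Ring.jacobson A := by
  have hz_mem : z ∈ radPow Aᵐᵒᵖ P 1 := by
    rw [radPow_eq_jacobson_pow_smul_top, Submodule.pow_one, ← radSub_eq_jacobson_smul_top]
    exact hk hz
  simpa [Submodule.pow_one] using apply_mem_jacobson_pow t hz_mem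

/-- Evaluation of `A`-linear maps from a radical layer to `Module.Dual F S` on the classes of
`v • t'` and then at `s`. -/
noncomputable def homDualEval (t' : P' →ₗ[Aᵐᵒᵖ] A) (m : ℕ) (s : S) :
    (radLayer A (P' →ₗ[Aᵐᵒᵖ] A) (m + 1) →ₗ[A] Module.Dual F S) →ₗ[F]
      Module.Dual F ((Ring.jacobson A ^ m).restrictScalars F) where
  toFun φ :=
    { toFun := fun v ↦ φ (layerClass F t' m v) s
      map_add' := fun v w ↦ by rw [map_add, map_add, LinearMap.add_apply]
      map_smul' := fun c v ↦ by
        rw [map_smul, LinearMap.map_smul_of_tower φ, LinearMap.smul_apply, RingHom.id_apply] }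
  map_add' _ _ := rfl
  map_smul' _ _ := rfl

theorem homDualEval_mem_dualAnnihilator
    (ht : ∀ x, op (t x) • p = x) (ht' : ∀ x, op (t' x) • p' = x) (π : P →ₗ[Aᵐᵒᵖ] S) (m : ℕ)
    (φ : radLayer A (P' →ₗ[Aᵐᵒᵖ] A) (m + 1) →ₗ[A] Module.Dual F S) :
    homDualEval t' m (π p) φ ∈ (peirceKer F (t p) (t' p') m).dualAnnihilator := by
  rw [Submodule.mem_dualAnnihilator]
  intro v hv
  change φ (layerClass F t' m v) (π p) = 0
  rw [hom_dual_apply_apply ht, smul_layerClass, layerClass_eq_zero ht' hv, map_zero,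
    LinearMap.zero_apply]

theorem homDualEval_injective
    (ht : ∀ x, op (t x) • p = x) (ht' : ∀ x, op (t' x) • p' = x) (π : P →ₗ[Aᵐᵒᵖ] S)
    (hs : Function.Surjective π) (m : ℕ) :
    Function.Injective (homDualEval (F := F) t' m (π p)) := by
  rw [injective_iff_map_eq_zero]
  intro φ hφ
  refine LinearMap.ext fun y ↦ LinearMap.ext fun s ↦ ?_
  obtain ⟨q, rfl⟩ := Submodule.Quotient.mk_surjective _ y
  obtain ⟨x, rfl⟩ := hs s
  rw [hom_dual_apply_apply ht, mk_eq_layerClass (F := F) ht', smul_layerClass]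
  exact LinearMap.congr_fun hφ _

theorem exists_homDualEval_eq
    (ht : ∀ x, op (t x) • p = x) (ht' : ∀ x, op (t' x) • p' = x)
    (π : P →ₗ[Aᵐᵒᵖ] S) (hs : Function.Surjective π) (hk : LinearMap.ker π ≤ radSub Aᵐᵒᵖ P)
    (m : ℕ) {l : Module.Dual F ((Ring.jacobson A ^ m).restrictScalars F)}
    (hl : l ∈ (peirceKer F (t p) (t' p') m).dualAnnihilator) :
    ∃ φ, homDualEval t' m (π p) φ = l := by
  obtain ⟨σ, hσ⟩ := (π.restrictScalars F).exists_rightInverse_of_surjective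
    (LinearMap.range_eq_top.2 hs)
  replace hσ (s : S) : π (σ s) = s := LinearMap.congr_fun hσ s
  rw [Submodule.mem_dualAnnihilator] at hl
  have hl_eq (v w) (hv : t p * (v.1 - w.1) * t' p' ∈ Ring.jacobson A ^ (m + 1)) :
      l v = l w := by
    rw [← sub_eq_zero, ← map_sub]
    exact hl _ hv
  have hmul {a b : A} (ha : a ∈ Ring.jacobson A) (hb : b ∈ Ring.jacobson A ^ m) :
      a * b ∈ Ring.jacobson A ^ (m + 1) := by
    rw [Ideal.IsTwoSided.pow_succ]
    exact Ideal.mul_mem_mul ha hb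
  let β (s : S) (q : radPow A (P' →ₗ[Aᵐᵒᵖ] A) m) : (Ring.jacobson A ^ m).restrictScalars F :=
    ⟨t (σ s) * q.1 p', Ideal.mul_mem_left _ _ (eval_mem_jacobson_pow p' q.2)⟩
  let g : radPow A (P' →ₗ[Aᵐᵒᵖ] A) m →ₗ[A] Module.Dual F S :=
    { toFun := fun q ↦
        { toFun := fun s ↦ l (β s q)
          map_add' := fun s s' ↦ by
            rw [← map_add]
            exact congrArg l (Subtype.ext (by simp [β, add_mul]))
          map_smul' := fun c s ↦ by
            rw [← map_smul]
            refine congrArg l (Subtype.ext ?_)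
            change t (σ (c • s)) * q.1 p' = c • (t (σ s) * q.1 p')
            rw [map_smul, LinearMap.map_smul_of_tower, smul_mul_assoc] }
      map_add' := fun q q' ↦ LinearMap.ext fun s ↦ by
        change l (β s (q + q')) = l (β s q) + l (β s q')
        rw [← map_add]
        exact congrArg l (Subtype.ext (by simp [β, mul_add]))
      map_smul' := fun a q ↦ LinearMap.ext fun s ↦ by
        change l (β s (a • q)) = l (β (op a • s) q)
        refine hl_eq _ _ (Ideal.mul_mem_right _ _ (Ideal.mul_mem_left _ _ ?_))
        change t (σ s) * (a * q.1 p') - t (σ (op a • s)) * q.1 p' ∈ _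
        have h1 : t (σ s) * (a * q.1 p') - t (σ (op a • s)) * q.1 p' =
            t (op a • σ s - σ (op a • s)) * q.1 p' := by
          simp [sub_mul, mul_assoc]
        rw [h1]
        exact hmul (apply_mem_jacobson_of_mem_ker hk t (by simp [hσ]))
          (eval_mem_jacobson_pow p' q.2) }
  have hg : (radPow A (P' →ₗ[Aᵐᵒᵖ] A) (m + 1)).comap
      (radPow A (P' →ₗ[Aᵐᵒᵖ] A) m).subtype ≤ LinearMap.ker g := by
    intro q hq
    refine LinearMap.ext fun s ↦ hl _ ?_
    exact Ideal.mul_mem_right _ _ (Ideal.mul_mem_left _ _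
      (Ideal.mul_mem_left _ _ (eval_mem_jacobson_pow p' (Submodule.mem_comap.1 hq))))
  refine ⟨Submodule.liftQ _ g hg, LinearMap.ext fun v ↦ ?_⟩
  refine hl_eq (β (π p) ⟨v.1 • t', smul_mem_radPow v.2 t'⟩) v ?_
  change t p * (t (σ (π p)) * (v.1 * t' p') - v.1) * t' p' ∈ _
  have h1 := apply_mul_apply_of_generator ht t p
  have h2 := apply_mul_apply_of_generator ht' t' p'
  have h3 : t p * (t (σ (π p)) * (v.1 * t' p') - v.1) * t' p' =
      t p * (t (σ (π p) - p) * v.1) * t' p' := by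
    rw [map_sub]
    simp only [mul_sub, sub_mul, mul_assoc, h2]
    rw [← mul_assoc (t p) (t p), h1]
  rw [h3]
  exact Ideal.mul_mem_right _ _ (Ideal.mul_mem_left _ _
    (hmul (apply_mem_jacobson_of_mem_ker hk t (by simp [hσ])) v.2))

theorem nonempty_hom_dual_equiv_dual_peirce
    (ht : ∀ x, op (t x) • p = x) (ht' : ∀ x, op (t' x) • p' = x)
    (π : P →ₗ[Aᵐᵒᵖ] S) (hs : Function.Surjective π) (hk : LinearMap.ker π ≤ radSub Aᵐᵒᵖ P)
    (m : ℕ) :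
    Nonempty ((radLayer A (P' →ₗ[Aᵐᵒᵖ] A) (m + 1) →ₗ[A] Module.Dual F S) ≃ₗ[F]
      Module.Dual F (_ ⧸ peirceKer F (t p) (t' p') m)) := by
  let Λ := (homDualEval (F := F) t' m (π p)).codRestrict _
    (homDualEval_mem_dualAnnihilator ht ht' π m)
  have hΛ : Function.Bijective Λ := by
    refine ⟨fun φ ψ h ↦ homDualEval_injective ht ht' π hs m (congrArg Subtype.val h), fun l ↦ ?_⟩
    obtain ⟨φ, hφ⟩ := exists_homDualEval_eq ht ht' π hs hk m l.2
    exact ⟨φ, Subtype.ext hφ⟩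
  exact ⟨(LinearEquiv.ofBijective Λ hΛ).trans (Submodule.dualQuotEquivDualAnnihilator _).symm⟩

end PeirceComponent

/-- **Dual symmetry** (generalized Landrock lemma): for a finite dimensional algebra `A` over a
field `F`, projective covers `Pi`, `Pj` of simple right `A`-modules `Si`, `Sj`, and `n ≥ 1`,
there is an `F`-linear isomorphism
`Hom_A(rad^{n-1} Pi / rad^n Pi, Sj) ≅ Hom_{Aᵒᵖ}(rad^{n-1} Pj^t / rad^n Pj^t, Si^*)`,
where `Pj^t = Hom_A(Pj, A)` is the `A`-dual (a right `Aᵒᵖ`-module, rendered as a left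
`A`-module) and `Si^* = Hom_F(Si, F)` is the `F`-dual.
Right `A`-modules are rendered as left modules over `Aᵐᵒᵖ`. -/
theorem dual_symmetry_radLayer
    (F A : Type*) [Field F] [Ring A] [Algebra F A] [FiniteDimensional F A]
    (Si Sj Pi Pj : Type*)
    [AddCommGroup Si] [Module Aᵐᵒᵖ Si] [Module F Si] [IsScalarTower F Aᵐᵒᵖ Si]
    [IsSimpleModule Aᵐᵒᵖ Si] [Module.Finite Aᵐᵒᵖ Si]
    [AddCommGroup Sj] [Module Aᵐᵒᵖ Sj] [Module F Sj] [IsScalarTower F Aᵐᵒᵖ Sj]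
    [IsSimpleModule Aᵐᵒᵖ Sj] [Module.Finite Aᵐᵒᵖ Sj]
    [AddCommGroup Pi] [Module Aᵐᵒᵖ Pi] [Module F Pi] [IsScalarTower F Aᵐᵒᵖ Pi]
    [Module.Finite Aᵐᵒᵖ Pi] [Module.Projective Aᵐᵒᵖ Pi]
    [AddCommGroup Pj] [Module Aᵐᵒᵖ Pj] [Module F Pj] [IsScalarTower F Aᵐᵒᵖ Pj]
    [Module.Finite Aᵐᵒᵖ Pj] [Module.Projective Aᵐᵒᵖ Pj]
    (πi : Pi →ₗ[Aᵐᵒᵖ] Si) (hsi : Function.Surjective πi)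
    (hki : LinearMap.ker πi ≤ radSub Aᵐᵒᵖ Pi)
    (πj : Pj →ₗ[Aᵐᵒᵖ] Sj) (hsj : Function.Surjective πj)
    (hkj : LinearMap.ker πj ≤ radSub Aᵐᵒᵖ Pj)
    (n : ℕ) (hn : 1 ≤ n) :
    Nonempty ((radLayer Aᵐᵒᵖ Pi n →ₗ[Aᵐᵒᵖ] Sj) ≃ₗ[F]
      (radLayer A (Pj →ₗ[Aᵐᵒᵖ] A) n →ₗ[A] Module.Dual F Si)) := by
  have : IsArtinianRing A := IsArtinianRing.of_finite F A
  have : Module.Finite F Aᵐᵒᵖ := Module.Finite.equiv (MulOpposite.opLinearEquiv F)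
  have : IsArtinianRing Aᵐᵒᵖ := IsArtinianRing.of_finite F Aᵐᵒᵖ
  obtain ⟨m, rfl⟩ := Nat.exists_eq_add_of_le' hn
  obtain ⟨p, t, ht⟩ := exists_generator_of_projectiveCover πi hsi hki
  obtain ⟨p', t', ht'⟩ := exists_generator_of_projectiveCover πj hsj hkj
  have := isSemisimpleModule_radLayer_succ (R := Aᵐᵒᵖ) Pi m
  have : Module.Finite Aᵐᵒᵖ (radLayer Aᵐᵒᵖ Pi (m + 1)) := inferInstance
  obtain ⟨e₁⟩ := nonempty_linearEquiv_hom_swap (F := F) (R := Aᵐᵒᵖ)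
    (radLayer Aᵐᵒᵖ Pi (m + 1)) Sj
  obtain ⟨e₂⟩ := nonempty_linearEquiv_hom_of_ker_le_radSub (F := F) πj hsj hkj
    (radLayer Aᵐᵒᵖ Pi (m + 1))
  obtain ⟨e₃⟩ := nonempty_peirce_equiv_hom_radLayer (F := F) ht ht' m
  obtain ⟨e₄⟩ := nonempty_hom_dual_equiv_dual_peirce (F := F) ht ht' πi hsi hki m
  obtain ⟨e₅⟩ : Nonempty ((_ ⧸ peirceKer F (t p) (t' p') m) ≃ₗ[F]
      Module.Dual F (_ ⧸ peirceKer F (t p) (t' p') m)) :=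
    ⟨LinearEquiv.ofFinrankEq _ _ Subspace.dual_finrank_eq.symm⟩
  exact ⟨e₁.trans <| e₂.trans <| e₃.symm.trans <| e₅.trans e₄.symm⟩
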